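/- Let n ≥ 1, let Ā ∈ ℂ^{n×n}, and let σ > 0. For any vector v ∈ ℂⁿ with ‖v‖ = 1 and any t > 0, the probability under the density ρ̃ of the event {A is invertible and ‖A⁻¹v‖ ≥ t} is at most 1/(4σ⁴t⁴); equivalently, ∫_{A invertible, ‖A⁻¹v‖ ≥ t} |det A|² ρ(A) dA ≤ (1/(4σ⁴t⁴)) · ∫_{ℂ^{n×n}} |det A|² ρ(A) dA. -/

import Mathlib

open MeasureTheory Matrix

/-- The density of the Gaussian distribution `N(Ā, σ²I)` on `ℂ^{n×n} ≅ ℝ^{2n²}`. -/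
noncomputable def matrixGaussianDensity {n : ℕ} (Abar : Matrix (Fin n) (Fin n) ℂ) (σ : ℝ)
    (A : Fin n → Fin n → ℂ) : ℝ :=
  ((2 * Real.pi * σ ^ 2) ^ (n ^ 2))⁻¹ *
    Real.exp (-(∑ i, ∑ j, ‖A i j - Abar i j‖ ^ 2) / (2 * σ ^ 2))

lemma gi0 {k : ℝ} (hk : 0 < k) : ∫ z : ℂ, Real.exp (-k * ‖z‖^2) = Real.pi / k := by
  have h := Complex.integral_rpow_mul_exp_neg_mul_rpow (p := 2) (q := 0) (b := k)
    (by norm_num) (by norm_num) hk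
  norm_num [Real.rpow_neg_one] at h
  rw [div_eq_mul_inv, ← h]
  simp

lemma gi2 {k : ℝ} (hk : 0 < k) :
    ∫ z : ℂ, ‖z‖^2 * Real.exp (-k * ‖z‖^2) = Real.pi / k^2 := by
  have h := Complex.integral_rpow_mul_exp_neg_mul_rpow (p := 2) (q := 2) (b := k)
    (by norm_num) (by norm_num) hk
  norm_num [Real.rpow_neg hk.le] at h
  rw [div_eq_mul_inv, ← h]
  simp

lemma gint0 {k : ℝ} (hk : 0 < k) : Integrable (fun z : ℂ => Real.exp (-k * ‖z‖^2)) := by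
  by_contra h
  have := integral_undef h
  rw [gi0 hk] at this
  have : 0 < Real.pi / k := by positivity
  linarith

lemma gint2 {k : ℝ} (hk : 0 < k) : Integrable (fun z : ℂ => ‖z‖^2 * Real.exp (-k * ‖z‖^2)) := by
  by_contra h
  have := integral_undef h
  rw [gi2 hk] at this
  have : 0 < Real.pi / k^2 := by positivity
  linarith

lemma gintb {k : ℝ} (hk : 0 < k) (b : ℂ) :
    Integrable (fun z : ℂ => ‖z + b‖^2 * Real.exp (-k * ‖z‖^2)) := by
  have h := (((gint2 hk).const_mul 2).add ((gint0 hk).const_mul (2 * ‖b‖^2)))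
  refine h.mono' (by fun_prop) (Filter.Eventually.of_forall fun z => ?_)
  rw [Real.norm_of_nonneg (by positivity)]
  have h1 : ‖z + b‖^2 ≤ 2 * ‖z‖^2 + 2 * ‖b‖^2 := by
    have := norm_add_le z b
    have h0 := norm_nonneg (z + b)
    nlinarith [sq_nonneg (‖z‖ - ‖b‖)]
  have := mul_le_mul_of_nonneg_right h1 (Real.exp_pos (-k * ‖z‖^2)).le
  simp only [Pi.add_apply]
  linarith

lemma lower1 {k : ℝ} (hk : 0 < k) (b : ℂ) :
    Real.pi / k^2 ≤ ∫ z : ℂ, ‖z‖^2 * Real.exp (-k * ‖z - b‖^2) := by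
  have e1 : ∫ z : ℂ, ‖z‖^2 * Real.exp (-k * ‖z - b‖^2)
      = ∫ z : ℂ, ‖z + b‖^2 * Real.exp (-k * ‖z‖^2) := by
    rw [← integral_add_right_eq_self _ b]
    simp
  have e2 : ∫ z : ℂ, ‖z + b‖^2 * Real.exp (-k * ‖z‖^2)
      = ∫ z : ℂ, ‖z + -b‖^2 * Real.exp (-k * ‖z‖^2) := by
    rw [← integral_neg_eq_self]
    congr 1
    ext z
    rw [norm_neg, show -z + b = -(z + -b) by ring, norm_neg]
  have e3 : ∫ z : ℂ, 2 * (‖z‖^2 * Real.exp (-k * ‖z‖^2)) ≤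
     ∫ z : ℂ, (‖z + b‖^2 * Real.exp (-k * ‖z‖^2) + ‖z + -b‖^2 * Real.exp (-k * ‖z‖^2)) := by
    refine integral_mono ((gint2 hk).const_mul 2) ((gintb hk b).add (gintb hk (-b))) fun z => ?_
    have := parallelogram_law_with_norm ℝ z b
    have h1 : 2 * ‖z‖^2 ≤ ‖z + b‖^2 + ‖z + -b‖^2 := by
      rw [← sub_eq_add_neg]; nlinarith [norm_nonneg b]
    have := mul_le_mul_of_nonneg_right h1 (Real.exp_pos (-k * ‖z‖^2)).le
    dsimp only
    linarith
  rw [integral_add (gintb hk b) (gintb hk (-b)), integral_const_mul, gi2 hk, ← e2] at e3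
  rw [e1]; linarith

lemma upper1 {k : ℝ} (hk : 0 < k) (b : ℂ) {t : ℝ} (ht : 0 < t) :
    ∫ z : ℂ, Set.indicator {z : ℂ | t * ‖z‖ ≤ 1} (fun z => ‖z‖^2) z * Real.exp (-k * ‖z - b‖^2)
      ≤ Real.pi / t^4 := by
  have hs : {z : ℂ | t * ‖z‖ ≤ 1} = Metric.closedBall 0 (1/t) := by
    ext z
    rw [Set.mem_ofPred_eq, mem_closedBall_zero_iff, le_div_iff₀ ht, mul_comm]
  have hfin : volume (Metric.closedBall (0:ℂ) (1/t)) ≠ ⊤ := (isCompact_closedBall _ _).measure_ne_top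
  calc _ ≤ ∫ z : ℂ, Set.indicator (Metric.closedBall 0 (1/t)) (fun _ => 1/t^2) z := by
        refine integral_mono_of_nonneg (Filter.Eventually.of_forall fun z => ?_) ?_
          (Filter.Eventually.of_forall fun z => ?_)
        · exact mul_nonneg (Set.indicator_nonneg (fun _ _ => by positivity) _) (Real.exp_pos _).le
        · rw [integrable_indicator_iff Metric.isClosed_closedBall.measurableSet]
          exact integrableOn_const hfin
        · dsimp only
          rw [hs]
          by_cases hz : z ∈ Metric.closedBall (0:ℂ) (1/t)
          · rw [Set.indicator_of_mem hz, Set.indicator_of_mem hz]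
            have h1 : ‖z‖ ≤ 1/t := by simpa using hz
            have h2 : Real.exp (-k * ‖z - b‖^2) ≤ 1 := by
              rw [Real.exp_le_one_iff]
              have : 0 ≤ k * ‖z - b‖^2 := by positivity
              linarith
            calc _ ≤ ‖z‖^2 * 1 := by gcongr
              _ ≤ (1/t)^2 := by rw [mul_one]; gcongr
              _ = _ := by simp
          · rw [Set.indicator_of_notMem hz, Set.indicator_of_notMem hz]; simp
    _ = _ := by
        rw [integral_indicator_const _ Metric.isClosed_closedBall.measurableSet, measureReal_def,
          Complex.volume_closedBall]
        simp [ENNReal.toReal_ofReal (inv_nonneg.2 ht.le)]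
        field_simp

lemma one_dim {σ : ℝ} (hσ : 0 < σ) (b : ℂ) {t : ℝ} (ht : 0 < t) :
    ∫ z : ℂ, Set.indicator {z : ℂ | t * ‖z‖ ≤ 1} (fun z => ‖z‖^2) z *
        Real.exp (-(1/(2*σ^2)) * ‖z - b‖^2)
      ≤ (1 / (4 * σ ^ 4 * t ^ 4)) * ∫ z : ℂ, ‖z‖^2 * Real.exp (-(1/(2*σ^2)) * ‖z - b‖^2) := by
  have hk : 0 < 1/(2*σ^2) := by positivity
  refine (upper1 hk b ht).trans ?_
  refine le_trans (le_of_eq ?_) (mul_le_mul_of_nonneg_left (lower1 hk b) (by positivity))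
  field_simp
  norm_num

lemma mp {E : Type*} [NormedAddCommGroup E] [NormedSpace ℝ E] [FiniteDimensional ℝ E]
    [MeasurableSpace E] [BorelSpace E] (μ : Measure E) [μ.IsAddHaarMeasure] (L : E ≃L[ℝ] E)
    (q : E → ℝ) (hq : Continuous q) (h0 : q 0 < 1) (hb : Bornology.IsBounded {x | q x < 1})
    (hL : ∀ x, q (L x) = q x) : MeasurePreserving L μ μ := by
  refine ⟨L.continuous.measurable, ?_⟩
  have h := Measure.isAddLeftInvariant_eq_smul (μ.map L) μ
  set c := (μ.map L).addHaarScalarFactor μ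
  have ho : IsOpen {x | q x < 1} := isOpen_lt hq continuous_const
  have h1 : (μ.map L) {x | q x < 1} = μ {x | q x < 1} := by
    rw [Measure.map_apply L.continuous.measurable ho.measurableSet]
    congr 1
    ext x
    simp [hL]
  have hp : μ {x | q x < 1} ≠ 0 := (ho.measure_pos μ ⟨0, h0⟩).ne'
  have hf : μ {x | q x < 1} ≠ ⊤ := hb.measure_lt_top.ne
  rw [h, Measure.smul_apply] at h1
  have hc : (c : ENNReal) = 1 := by
    have : (c : ENNReal) * μ {x | q x < 1} = 1 * μ {x | q x < 1} := by rw [one_mul]; exact h1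
    exact (ENNReal.mul_left_inj hp hf).1 this
  have hc' : c = 1 := by exact_mod_cast hc
  rw [h, hc', one_smul]

lemma unit_norm {ι : Type*} [Fintype ι] [DecidableEq ι] (U : Matrix ι ι ℂ) (hU : Uᴴ * U = 1)
    (x : ι → ℂ) : ∑ i, ‖(U *ᵥ x) i‖^2 = ∑ i, ‖x i‖^2 := by
  have key : ∀ y : ι → ℂ, ((∑ i, ‖y i‖^2 : ℝ) : ℂ) = star y ⬝ᵥ y := by
    intro y
    simp [dotProduct, Complex.conj_mul']
  have : ((∑ i, ‖(U *ᵥ x) i‖^2 : ℝ) : ℂ) = ((∑ i, ‖x i‖^2 : ℝ) : ℂ) := by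
    rw [key, key, star_mulVec, dotProduct_mulVec, vecMul_vecMul, hU, vecMul_one]
  exact_mod_cast this

lemma exists_unitary {m : ℕ} (c : Fin (m+1) → ℂ) (hc : ∑ i, ‖c i‖^2 = 1) :
    ∃ U : Matrix (Fin (m+1)) (Fin (m+1)) ℂ, Uᴴ * U = 1 ∧ U * Uᴴ = 1 ∧ U *ᵥ c = Pi.single 0 1 := by
  let w : Fin (m+1) → EuclideanSpace ℂ (Fin (m+1)) := fun _ => WithLp.toLp 2 c
  have hw : Orthonormal ℂ (Set.domRestrict ({0} : Set (Fin (m+1))) w) := by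
    constructor
    · intro i
      simp [w, Set.domRestrict, EuclideanSpace.norm_eq, hc]
    · intro i j hij
      exact absurd (Subsingleton.elim i j) hij
  obtain ⟨b, hb⟩ := hw.exists_orthonormalBasis_extension_of_card_eq (by simp)
  have hb0 := hb 0 rfl
  have hM := (EuclideanSpace.basisFun (Fin (m+1)) ℂ).toMatrix_orthonormalBasis_mem_unitary b
  set M := (EuclideanSpace.basisFun (Fin (m+1)) ℂ).toBasis.toMatrix b
  have h1 : Mᴴ * M = 1 := (Matrix.mem_unitaryGroup_iff'.1 hM)
  have h2 : M * Mᴴ = 1 := (Matrix.mem_unitaryGroup_iff.1 hM)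
  have h3 : M *ᵥ Pi.single 0 1 = c := by
    ext i
    simp [M, Module.Basis.toMatrix_apply, hb0, w]
  refine ⟨Mᴴ, by simpa using h2, by simpa using h1, ?_⟩
  rw [← h3, mulVec_mulVec, h1, one_mulVec]

lemma vec_mp {n : ℕ} (V : Matrix (Fin n) (Fin n) ℂ) (h1 : Vᴴ * V = 1) (h2 : V * Vᴴ = 1) :
    MeasurableEmbedding (fun x : Fin n → ℂ => V *ᵥ x) ∧
    MeasurePreserving (fun x : Fin n → ℂ => V *ᵥ x) := by
  let L0 : (Fin n → ℂ) ≃ₗ[ℝ] (Fin n → ℂ) :=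
    { toFun := fun x => V *ᵥ x
      invFun := fun x => Vᴴ *ᵥ x
      map_add' := fun x y => mulVec_add _ _ _
      map_smul' := fun r x => mulVec_smul _ _ _
      left_inv := fun x => by simp [h1]
      right_inv := fun x => by simp [h2] }
  let L := L0.toContinuousLinearEquiv
  have hL : (L : (Fin n → ℂ) → (Fin n → ℂ)) = fun x => V *ᵥ x := rfl
  rw [← hL]
  refine ⟨L.toHomeomorph.measurableEmbedding, ?_⟩
  refine mp volume L (fun x => ∑ i, ‖x i‖^2) (by fun_prop) (by simp) ?_ ?_
  · refine (Metric.isBounded_closedBall (x := (0 : Fin n → ℂ)) (r := 1)).subset fun x hx => ?_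
    rw [mem_closedBall_zero_iff, pi_norm_le_iff_of_nonneg zero_le_one]
    intro i
    have := Finset.single_le_sum (f := fun i => ‖x i‖^2) (fun i _ => by positivity)
      (Finset.mem_univ i)
    have hx' : ∑ i, ‖x i‖^2 < 1 := hx
    nlinarith [norm_nonneg (x i)]
  · intro x
    exact unit_norm V h1 x

lemma frob {n : ℕ} (V : Matrix (Fin n) (Fin n) ℂ) (h1 : Vᴴ * V = 1)
    (A : Matrix (Fin n) (Fin n) ℂ) :
    ∑ i, ∑ j, ‖(V * A) i j‖^2 = ∑ i, ∑ j, ‖A i j‖^2 := by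
  rw [Finset.sum_comm, Finset.sum_comm (f := fun i j => ‖A i j‖^2)]
  exact Finset.sum_congr rfl fun j _ => unit_norm V h1 (fun i => A i j)

/-- Left multiplication by a matrix, on plain arrays. -/
def leftMul {n : ℕ} (V : Matrix (Fin n) (Fin n) ℂ) (A : Fin n → Fin n → ℂ) : Fin n → Fin n → ℂ :=
  fun i j => (V * Matrix.of A) i j

lemma mat_mp {n : ℕ} (V : Matrix (Fin n) (Fin n) ℂ) (h1 : Vᴴ * V = 1) (h2 : V * Vᴴ = 1) :
    MeasurableEmbedding (leftMul V) ∧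
    MeasurePreserving (leftMul V) := by
  let L0 : (Fin n → Fin n → ℂ) ≃ₗ[ℝ] (Fin n → Fin n → ℂ) :=
    { toFun := fun A => (V * Matrix.of A : Matrix (Fin n) (Fin n) ℂ)
      invFun := fun A => (Vᴴ * Matrix.of A : Matrix (Fin n) (Fin n) ℂ)
      map_add' := fun x y => Matrix.mul_add V (Matrix.of x) (Matrix.of y)
      map_smul' := fun r x => Matrix.mul_smul V r (Matrix.of x)
      left_inv := fun x => by
        change Vᴴ * (V * Matrix.of x) = Matrix.of x
        rw [← Matrix.mul_assoc, h1, Matrix.one_mul]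
      right_inv := fun x => by
        change V * (Vᴴ * Matrix.of x) = Matrix.of x
        rw [← Matrix.mul_assoc, h2, Matrix.one_mul] }
  let L := L0.toContinuousLinearEquiv
  have hL : (L : (Fin n → Fin n → ℂ) → (Fin n → Fin n → ℂ)) =
    leftMul V := rfl
  rw [← hL]
  refine ⟨L.toHomeomorph.measurableEmbedding, ?_⟩
  have : (volume : Measure (Fin n → Fin n → ℂ)).IsAddHaarMeasure :=
    Measure.pi.isAddHaarMeasure (fun _ : Fin n => (volume : Measure (Fin n → ℂ)))
  refine mp volume L (fun x => ∑ i, ∑ j, ‖x i j‖^2) (by fun_prop) (by simp) ?_ ?_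
  · refine (Metric.isBounded_closedBall (x := (0 : Fin n → Fin n → ℂ)) (r := 1)).subset
      fun x hx => ?_
    rw [mem_closedBall_zero_iff, pi_norm_le_iff_of_nonneg zero_le_one]
    intro i
    rw [pi_norm_le_iff_of_nonneg zero_le_one]
    intro j
    have a1 := Finset.single_le_sum (f := fun i => ∑ j, ‖x i j‖^2) (fun i _ => by positivity)
      (Finset.mem_univ i)
    have a2 := Finset.single_le_sum (f := fun j => ‖x i j‖^2) (fun i _ => by positivity)
      (Finset.mem_univ j)
    have hx' : ∑ i, ∑ j, ‖x i j‖^2 < 1 := hx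
    nlinarith [norm_nonneg (x i j)]
  · intro x
    exact frob V h1 (Matrix.of x)

/-- The product case. -/
lemma row_prod {m : ℕ} {σ : ℝ} (b : Fin (m+1) → ℂ) (f : ℂ → ℝ) :
    ∫ a : Fin (m+1) → ℂ, f (a 0) * Real.exp (-(1/(2*σ^2)) * ∑ j, ‖a j - b j‖^2)
     = (∫ z : ℂ, f z * Real.exp (-(1/(2*σ^2)) * ‖z - b 0‖^2)) *
       ∏ j : Fin m, ∫ z : ℂ, Real.exp (-(1/(2*σ^2)) * ‖z - b j.succ‖^2) := by
  have h := integral_fintype_prod_volume_eq_prod (𝕜 := ℝ) (E := fun _ : Fin (m+1) => ℂ)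
    (fun j z => (if j = 0 then f z else 1) * Real.exp (-(1/(2*σ^2)) * ‖z - b j‖^2))
  rw [Fin.prod_univ_succ] at h
  simp only [if_true, Fin.succ_ne_zero, if_false, one_mul] at h
  rw [← h]
  congr 1
  ext a
  rw [Finset.prod_mul_distrib, Finset.mul_sum, Real.exp_sum]
  congr 1
  simp

lemma row_unit {m : ℕ} {σ : ℝ} (hσ : 0 < σ) {t : ℝ} (ht : 0 < t) (b c : Fin (m+1) → ℂ)
    (hc : ∑ i, ‖c i‖^2 = 1) :
    ∫ a : Fin (m+1) → ℂ, Set.indicator {z : ℂ | t * ‖z‖ ≤ 1} (fun z => ‖z‖^2) (a ⬝ᵥ c) *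
        Real.exp (-(1/(2*σ^2)) * ∑ j, ‖a j - b j‖^2)
      ≤ (1 / (4 * σ ^ 4 * t ^ 4)) * ∫ a : Fin (m+1) → ℂ, ‖a ⬝ᵥ c‖^2 *
        Real.exp (-(1/(2*σ^2)) * ∑ j, ‖a j - b j‖^2) := by
  obtain ⟨U, h1, h2, hU⟩ := exists_unitary c hc
  have k1 : (Uᵀ)ᴴ * Uᵀ = 1 := by
    have := congrArg Matrix.transpose h2
    simpa [Matrix.transpose_mul, conjTranspose, Matrix.transpose_map] using this
  have k2 : Uᵀ * (Uᵀ)ᴴ = 1 := by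
    have := congrArg Matrix.transpose h1
    simpa [Matrix.transpose_mul, conjTranspose, Matrix.transpose_map] using this
  obtain ⟨hemb, hmp⟩ := vec_mp Uᵀ k1 k2
  have key : ∀ f : ℂ → ℝ, ∫ a : Fin (m+1) → ℂ, f (a ⬝ᵥ c) *
        Real.exp (-(1/(2*σ^2)) * ∑ j, ‖a j - b j‖^2) =
      ∫ a : Fin (m+1) → ℂ, f (a 0) *
        Real.exp (-(1/(2*σ^2)) * ∑ j, ‖a j - ((Uᵀ)ᴴ *ᵥ b) j‖^2) := by
    intro f
    rw [← hmp.integral_comp hemb]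
    congr 1
    ext a
    have e1 : (Uᵀ *ᵥ a) ⬝ᵥ c = a 0 := by
      rw [mulVec_transpose, ← dotProduct_mulVec, hU]; simp
    have e2 : ∑ j, ‖(Uᵀ *ᵥ a) j - b j‖^2 = ∑ j, ‖a j - ((Uᵀ)ᴴ *ᵥ b) j‖^2 := by
      have := unit_norm Uᵀ k1 (a - (Uᵀ)ᴴ *ᵥ b)
      rw [mulVec_sub, mulVec_mulVec, k2, one_mulVec] at this
      exact this
    rw [e1, e2]
  rw [key, key (fun z => ‖z‖^2), row_prod, row_prod _ (fun z => ‖z‖^2), ← mul_assoc]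
  refine mul_le_mul_of_nonneg_right (one_dim hσ _ ht) ?_
  exact Finset.prod_nonneg fun j _ => integral_nonneg fun z => (Real.exp_pos _).le

lemma row_gen {m : ℕ} {σ : ℝ} (hσ : 0 < σ) {t : ℝ} (ht : 0 < t) (b c : Fin (m+1) → ℂ) :
    ∫ a : Fin (m+1) → ℂ, Set.indicator {z : ℂ | t * ‖z‖ ≤ Real.sqrt (∑ i, ‖c i‖^2)}
        (fun z => ‖z‖^2) (a ⬝ᵥ c) *
        Real.exp (-(1/(2*σ^2)) * ∑ j, ‖a j - b j‖^2)
      ≤ (1 / (4 * σ ^ 4 * t ^ 4)) * ∫ a : Fin (m+1) → ℂ, ‖a ⬝ᵥ c‖^2 *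
        Real.exp (-(1/(2*σ^2)) * ∑ j, ‖a j - b j‖^2) := by
  by_cases hc : c = 0
  · subst hc
    simp [Set.indicator]
  have hpos : 0 < ∑ i, ‖c i‖^2 := by
    obtain ⟨i, hi⟩ := Function.ne_iff.1 hc
    refine Finset.sum_pos' (fun i _ => by positivity) ⟨i, Finset.mem_univ i, ?_⟩
    have : 0 < ‖c i‖ := norm_pos_iff.2 hi
    positivity
  set s := Real.sqrt (∑ i, ‖c i‖^2) with hs
  have hs0 : 0 < s := Real.sqrt_pos.2 hpos
  have hs2 : s^2 = ∑ i, ‖c i‖^2 := Real.sq_sqrt hpos.le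
  let c' : Fin (m+1) → ℂ := fun i => c i / (s : ℂ)
  have hc' : ∑ i, ‖c' i‖^2 = 1 := by
    simp only [c', norm_div, div_pow, ← Finset.sum_div, ← hs2]
    simp [hs0.ne']
  have hd : ∀ a : Fin (m+1) → ℂ, a ⬝ᵥ c = s * (a ⬝ᵥ c') := by
    intro a
    have : (s : ℂ) ≠ 0 := by exact_mod_cast hs0.ne'
    simp only [dotProduct, Finset.mul_sum, c']
    refine Finset.sum_congr rfl fun i _ => ?_
    field_simp
  have hn : ∀ a : Fin (m+1) → ℂ, ‖a ⬝ᵥ c‖ = s * ‖a ⬝ᵥ c'‖ := by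
    intro a; rw [hd, norm_mul]; simp [hs0.le]
  have hi : ∀ a : Fin (m+1) → ℂ, Set.indicator {z : ℂ | t * ‖z‖ ≤ s} (fun z => ‖z‖^2) (a ⬝ᵥ c)
      = s^2 * Set.indicator {z : ℂ | t * ‖z‖ ≤ 1} (fun z => ‖z‖^2) (a ⬝ᵥ c') := by
    intro a
    have : t * (s * ‖a ⬝ᵥ c'‖) ≤ s ↔ t * ‖a ⬝ᵥ c'‖ ≤ 1 := by
      rw [show t * (s * ‖a ⬝ᵥ c'‖) = s * (t * ‖a ⬝ᵥ c'‖) by ring]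
      exact mul_le_iff_le_one_right hs0
    simp only [Set.indicator, Set.mem_ofPred_eq, hn, this]
    split_ifs <;> ring
  have hr := row_unit hσ ht b c' hc'
  simp only [hi, hn, mul_pow, mul_assoc, integral_const_mul]
  simp only [mul_assoc] at hr
  rw [mul_left_comm]
  exact mul_le_mul_of_nonneg_left hr (by positivity)

lemma gauss_integrable {n : ℕ} {k : ℝ} (hk : 0 < k) (B : Fin n → Fin n → ℂ) :
    Integrable (fun A : Fin n → Fin n → ℂ => Real.exp (-k * ∑ i, ∑ j, ‖A i j - B i j‖^2)) := by
  have h : ∀ i, Integrable (fun a : Fin n → ℂ => ∏ j, Real.exp (-k * ‖a j - B i j‖^2)) := by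
    intro i
    refine Integrable.fintype_prod (μ := fun _ : Fin n => (volume : Measure ℂ))
      (f := fun j z => Real.exp (-k * ‖z - B i j‖^2)) fun j => ?_
    exact (gint0 hk).comp_sub_right (B i j)
  have h2 : Integrable (fun A : Fin n → Fin n → ℂ =>
      ∏ i, (fun i (a : Fin n → ℂ) => ∏ j, Real.exp (-k * ‖a j - B i j‖^2)) i (A i))
      (Measure.pi fun _ : Fin n => (volume : Measure (Fin n → ℂ))) :=
    Integrable.fintype_prod h
  rw [← volume_pi] at h2
  have e : (fun A : Fin n → Fin n → ℂ => Real.exp (-k * ∑ i, ∑ j, ‖A i j - B i j‖^2)) =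
      (fun A : Fin n → Fin n → ℂ =>
      ∏ i, (fun i (a : Fin n → ℂ) => ∏ j, Real.exp (-k * ‖a j - B i j‖^2)) i (A i)) := by
    funext A
    simp only [Finset.mul_sum, Real.exp_sum]
  rw [e]
  exact h2

lemma main_integrable {n : ℕ} {σ : ℝ} (hσ : 0 < σ) (B : Matrix (Fin n) (Fin n) ℂ) :
    Integrable (fun A : Fin n → Fin n → ℂ =>
      ‖(Matrix.of A).det‖^2 * matrixGaussianDensity B σ A) := by
  have hdc : Continuous (fun A : Fin n → Fin n → ℂ => (Matrix.of A).det) :=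
    Continuous.matrix_det continuous_id
  set k : ℝ := 1/(4*σ^2) with hk
  have hk0 : 0 < k := by positivity
  set β : ℝ := ∑ i, ∑ j, ‖B i j‖^2 with hβ
  have hβ0 : 0 ≤ β := by positivity
  set D : ℝ := ((2 * Real.pi * σ ^ 2) ^ (n ^ 2))⁻¹
  have hD : 0 ≤ D := by positivity
  set M : ℝ := (n.factorial : ℝ)^2 * ((2/k)^n * (n.factorial * Real.exp (k * β))) * D
  refine ((gauss_integrable hk0 B).const_mul M).mono' ?_ (Filter.Eventually.of_forall fun A => ?_)
  · apply Continuous.aestronglyMeasurable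
    unfold matrixGaussianDensity
    fun_prop
  set S : ℝ := ∑ i, ∑ j, ‖A i j - B i j‖^2 with hS
  have hS0 : 0 ≤ S := by positivity
  have hent : ∀ i j, ‖A i j‖ ≤ Real.sqrt (2 * (S + β)) := by
    intro i j
    apply Real.le_sqrt_of_sq_le
    have a1 : ‖A i j - B i j‖^2 ≤ S :=
      (Finset.single_le_sum (f := fun j => ‖A i j - B i j‖^2) (fun i _ => by positivity)
        (Finset.mem_univ j)).trans
      (Finset.single_le_sum (f := fun i => ∑ j, ‖A i j - B i j‖^2) (fun i _ => by positivity)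
        (Finset.mem_univ i))
    have a2 : ‖B i j‖^2 ≤ β :=
      (Finset.single_le_sum (f := fun j => ‖B i j‖^2) (fun i _ => by positivity)
        (Finset.mem_univ j)).trans
      (Finset.single_le_sum (f := fun i => ∑ j, ‖B i j‖^2) (fun i _ => by positivity)
        (Finset.mem_univ i))
    have a3 : ‖A i j‖ ≤ ‖A i j - B i j‖ + ‖B i j‖ := by
      have := norm_add_le (A i j - B i j) (B i j)
      simpa using this
    nlinarith [norm_nonneg (A i j), sq_nonneg (‖A i j - B i j‖ - ‖B i j‖)]
  have hdet : ‖(Matrix.of A).det‖ ≤ n.factorial * (Real.sqrt (2 * (S + β)))^n := by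
    have := Matrix.det_le (A := Matrix.of A) (abv := NormedField.toAbsoluteValue ℂ)
      (x := Real.sqrt (2 * (S + β))) (fun i j => hent i j)
    rw [Fintype.card_fin, nsmul_eq_mul] at this
    exact this
  have hdet2 : ‖(Matrix.of A).det‖^2 ≤ (n.factorial : ℝ)^2 * (2 * (S + β))^n := by
    calc _ ≤ (n.factorial * (Real.sqrt (2 * (S + β)))^n)^2 := by gcongr
      _ = (n.factorial : ℝ)^2 * ((Real.sqrt (2 * (S + β)))^2)^n := by ring
      _ = _ := by rw [Real.sq_sqrt (by positivity)]
  have hexp : (2 * (S + β))^n ≤ (2/k)^n * (n.factorial * (Real.exp (k*β) * Real.exp (k * S))) := by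
    have h := Real.pow_div_factorial_le_exp (k * (S + β)) (by positivity) n
    rw [div_le_iff₀ (by positivity)] at h
    calc (2 * (S + β))^n = (2/k)^n * (k * (S+β))^n := by
          rw [← mul_pow]; congr 1; field_simp
      _ ≤ (2/k)^n * (Real.exp (k * (S+β)) * n.factorial) := by gcongr
      _ = _ := by rw [mul_add, Real.exp_add]; ring
  have hρ : matrixGaussianDensity B σ A = D * (Real.exp (-k * S) * Real.exp (-k * S)) := by
    unfold matrixGaussianDensity
    rw [← Real.exp_add]
    congr 2
    rw [← hS, hk]; field_simp; ring
  rw [hρ, Real.norm_of_nonneg (by positivity)]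
  have hcancel : Real.exp (k * S) * Real.exp (-k * S) = 1 := by
    rw [← Real.exp_add]; simp
  calc _ ≤ ((n.factorial : ℝ)^2 * ((2/k)^n * (n.factorial * (Real.exp (k*β) * Real.exp (k * S)))))
        * (D * (Real.exp (-k * S) * Real.exp (-k * S))) := by
        refine mul_le_mul_of_nonneg_right (hdet2.trans ?_) (by positivity)
        gcongr
    _ = M * Real.exp (-k * S) * (Real.exp (k * S) * Real.exp (-k * S)) := by ring
    _ = _ := by rw [hcancel, mul_one]

/-- cofactors along the zeroth row -/
noncomputable def cof {m : ℕ} (R : Fin m → Fin (m+1) → ℂ) (j : Fin (m+1)) : ℂ :=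
  (Matrix.of (Fin.cons 0 R : Fin (m+1) → Fin (m+1) → ℂ)).adjugate j 0

lemma adj_cons {m : ℕ} (a : Fin (m+1) → ℂ) (R : Fin m → Fin (m+1) → ℂ) (j : Fin (m+1)) :
    (Matrix.of (Fin.cons a R : Fin (m+1) → Fin (m+1) → ℂ)).adjugate j 0 = cof R j := by
  unfold cof
  rw [adjugate_apply, adjugate_apply]
  congr 1
  ext i l
  refine Fin.cases ?_ (fun i => ?_) i
  · simp
  · simp [updateRow_apply]

lemma det_cons {m : ℕ} (a : Fin (m+1) → ℂ) (R : Fin m → Fin (m+1) → ℂ) :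
    (Matrix.of (Fin.cons a R : Fin (m+1) → Fin (m+1) → ℂ)).det = a ⬝ᵥ cof R := by
  rw [Matrix.det_eq_sum_mul_adjugate_row _ 0]
  simp [adj_cons, dotProduct]

lemma e0_case {m : ℕ} (B : Matrix (Fin (m+1)) (Fin (m+1)) ℂ) {σ : ℝ} (hσ : 0 < σ) {t : ℝ}
    (ht : 0 < t) :
    ∫ A in {A : Fin (m+1) → Fin (m+1) → ℂ | IsUnit (Matrix.of A).det ∧
        t ≤ Real.sqrt (∑ i, ‖((Matrix.of A)⁻¹ *ᵥ (Pi.single 0 1 : Fin (m+1) → ℂ)) i‖ ^ 2)},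
        ‖(Matrix.of A).det‖ ^ 2 * matrixGaussianDensity B σ A
      ≤ (1 / (4 * σ ^ 4 * t ^ 4)) *
        ∫ A : Fin (m+1) → Fin (m+1) → ℂ, ‖(Matrix.of A).det‖ ^ 2 * matrixGaussianDensity B σ A := by
  have hint := main_integrable hσ B
  have hnn : ∀ A, 0 ≤ ‖(Matrix.of A).det‖ ^ 2 * matrixGaussianDensity B σ A := by
    intro A; unfold matrixGaussianDensity; positivity
  let S' : Set (Fin (m+1) → Fin (m+1) → ℂ) := {A | t * ‖(Matrix.of A).det‖ ≤
    Real.sqrt (∑ i, ‖(Matrix.of A).adjugate i 0‖^2)}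
  have hS' : MeasurableSet S' := by
    have hdc : Continuous (fun A : Fin (m+1) → Fin (m+1) → ℂ => (Matrix.of A).det) :=
      Continuous.matrix_det continuous_id
    have hac : Continuous (fun A : Fin (m+1) → Fin (m+1) → ℂ => (Matrix.of A).adjugate) :=
      Continuous.matrix_adjugate continuous_id
    have hac' : ∀ i, Continuous (fun A : Fin (m+1) → Fin (m+1) → ℂ =>
      (Matrix.of A).adjugate i 0) := fun i => hac.matrix_elem i 0
    refine IsClosed.measurableSet (isClosed_le ?_ ?_) <;> fun_prop
  refine (setIntegral_mono_set (t := S') hint.integrableOn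
    (Filter.Eventually.of_forall hnn) (Filter.Eventually.of_forall ?_)).trans ?_
  · rintro A ⟨hA, hA2⟩
    have hdet : 0 < ‖(Matrix.of A).det‖ := norm_pos_iff.2 hA.ne_zero
    change t * ‖(Matrix.of A).det‖ ≤ Real.sqrt (∑ i, ‖(Matrix.of A).adjugate i 0‖^2)
    have e : ∀ i, (Matrix.of A).adjugate i 0 = (Matrix.of A).det *
        ((Matrix.of A)⁻¹ *ᵥ (Pi.single 0 1 : Fin (m+1) → ℂ)) i := by
      intro i
      rw [Matrix.inv_def, Ring.inverse_eq_inv']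
      simp
      rw [mul_inv_cancel_left₀ hA.ne_zero]
    simp only [e, norm_mul, mul_pow]
    rw [← Finset.mul_sum, Real.sqrt_mul (by positivity), Real.sqrt_sq hdet.le, mul_comm]
    gcongr
  rw [← integral_indicator hS']
  have hint' := hint.indicator hS'
  have hmp := (volume_preserving_piFinSuccAbove (fun _ : Fin (m+1) => Fin (m+1) → ℂ) 0).symm
  have hemb := (MeasurableEquiv.piFinSuccAbove (fun _ : Fin (m+1) => Fin (m+1) → ℂ) 0).symm.measurableEmbedding
  have hi1 := (hmp.integrable_comp_emb hemb).2 hint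
  have hi2 := (hmp.integrable_comp_emb hemb).2 hint'
  rw [← hmp.integral_comp hemb, ← hmp.integral_comp hemb]
  rw [Measure.volume_eq_prod] at hi1 hi2 ⊢
  have f1 := integral_prod_symm _ hi1
  have f2 := integral_prod_symm _ hi2
  have g1 := hi1.integral_prod_right
  have g2 := hi2.integral_prod_right
  simp only [Function.comp_def] at f1 f2 g1 g2
  rw [f1, f2, ← integral_const_mul]
  refine integral_mono g2 (g1.const_mul _) fun R => ?_
  have hcons : ∀ a, (MeasurableEquiv.piFinSuccAbove (fun _ : Fin (m+1) => Fin (m+1) → ℂ) 0).symm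
      (a, R) = (Fin.cons a R : Fin (m+1) → Fin (m+1) → ℂ) := by
    intro a
    simp [MeasurableEquiv.piFinSuccAbove]
    rfl
  simp only [hcons]
  set D : ℝ := ((2 * Real.pi * σ ^ 2) ^ ((m+1) ^ 2))⁻¹ *
    Real.exp (-(1/(2*σ^2)) * ∑ i : Fin m, ∑ j, ‖R i j - B i.succ j‖^2) with hD
  have hρ : ∀ a, matrixGaussianDensity B σ (Fin.cons a R : Fin (m+1) → Fin (m+1) → ℂ) =
      Real.exp (-(1/(2*σ^2)) * ∑ j, ‖a j - B 0 j‖^2) * D := by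
    intro a
    unfold matrixGaussianDensity
    rw [hD, mul_left_comm, ← Real.exp_add, Fin.sum_univ_succ]
    congr 2
    simp only [Fin.cons_zero, Fin.cons_succ]
    ring
  have hind : ∀ a, S'.indicator (fun A => ‖(Matrix.of A).det‖ ^ 2 * matrixGaussianDensity B σ A)
      (Fin.cons a R) = Set.indicator {z : ℂ | t * ‖z‖ ≤ Real.sqrt (∑ i, ‖cof R i‖^2)}
        (fun z => ‖z‖^2) (a ⬝ᵥ cof R) *
        Real.exp (-(1/(2*σ^2)) * ∑ j, ‖a j - B 0 j‖^2) * D := by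
    intro a
    simp only [Set.indicator, S', Set.mem_ofPred_eq, det_cons, adj_cons, hρ]
    split_ifs
    · ring
    · ring
  simp only [hind, det_cons, hρ, ← mul_assoc, integral_mul_const]
  exact mul_le_mul_of_nonneg_right (row_gen hσ ht (B 0) (cof R)) (by positivity)

/-- Tail bound (Lemma `le:tbrho`): for a unit vector `v` and any `t > 0`, the probability
under the density `ρ̃ ∝ |det A|² ρ(A)` of the event `{A invertible and ‖A⁻¹v‖ ≥ t}`
is at most `1/(4σ⁴t⁴)`, stated as an inequality of integrals. -/
theorem prob_inv_apply_unit_vector_ge_le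
    (n : ℕ) (hn : 1 ≤ n) (Abar : Matrix (Fin n) (Fin n) ℂ) (σ : ℝ) (hσ : 0 < σ)
    (v : Fin n → ℂ) (hv : ∑ i, ‖v i‖ ^ 2 = 1) (t : ℝ) (ht : 0 < t) :
    ∫ A in {A : Fin n → Fin n → ℂ | IsUnit (Matrix.of A).det ∧
        t ≤ Real.sqrt (∑ i, ‖((Matrix.of A)⁻¹ *ᵥ v) i‖ ^ 2)},
        ‖(Matrix.of A).det‖ ^ 2 * matrixGaussianDensity Abar σ A
      ≤ (1 / (4 * σ ^ 4 * t ^ 4)) *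
        ∫ A : Fin n → Fin n → ℂ, ‖(Matrix.of A).det‖ ^ 2 * matrixGaussianDensity Abar σ A := by
  obtain ⟨m, rfl⟩ : ∃ m, n = m + 1 := ⟨n - 1, by omega⟩
  obtain ⟨U, h1, h2, hU⟩ := exists_unitary v hv
  obtain ⟨hemb, hmp⟩ := mat_mp Uᴴ (by simpa using h2) (by simpa using h1)
  have hof : ∀ A, Matrix.of (leftMul Uᴴ A) = Uᴴ * Matrix.of A := fun A => rfl
  have hdU : ‖(Uᴴ).det‖ = 1 := by
    have h := congrArg Matrix.det h1
    rw [det_mul, det_conjTranspose, det_one] at h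
    have h' := congrArg norm h
    rw [norm_mul, norm_star, norm_one] at h'
    rw [det_conjTranspose, norm_star]
    nlinarith [norm_nonneg U.det]
  have hUu : IsUnit (Uᴴ).det := by
    rw [isUnit_iff_ne_zero, ← norm_pos_iff, hdU]; exact one_pos
  have hF : ∀ A, ‖(Matrix.of (leftMul Uᴴ A)).det‖ ^ 2 *
      matrixGaussianDensity Abar σ (leftMul Uᴴ A) =
      ‖(Matrix.of A).det‖^2 * matrixGaussianDensity (U * Abar) σ A := by
    intro A
    rw [hof, det_mul, norm_mul, hdU, one_mul]
    unfold matrixGaussianDensity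
    have h := frob Uᴴ (by simpa using h2) (Matrix.of A - U * Abar)
    rw [Matrix.mul_sub, ← Matrix.mul_assoc, h1, Matrix.one_mul] at h
    have h' : ∑ i, ∑ j, ‖leftMul Uᴴ A i j - Abar i j‖^2 =
      ∑ i, ∑ j, ‖A i j - (U * Abar) i j‖^2 := h
    rw [h']
  rw [← hmp.setIntegral_preimage_emb hemb, ← hmp.integral_comp hemb]
  simp only [hF]
  convert! e0_case (U * Abar) hσ ht using 3
  ext A
  simp only [Set.mem_preimage, Set.mem_ofPred_eq, hof, det_mul, IsUnit.mul_iff, hUu, true_and]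
  rw [Matrix.mul_inv_rev, ← mulVec_mulVec, Matrix.inv_eq_right_inv h1, hU]
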